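/- arXiv:2105.09715 — 4 statements merged into one kernel-verified Lean document; each statement's English description precedes it below -/
import Mathlib

section
/- For every A ∈ B(H), w(A) ≥ ‖A‖/2 + |‖Re(A)‖ − ‖Im(A)‖|/2. -/
open ContinuousLinearMap Filter
open scoped ComplexInnerProductSpace Topology

variable {H : Type*} [NormedAddCommGroup H] [InnerProductSpace ℂ H]
  [CompleteSpace H] [Nontrivial H]

/-- The numerical range of a bounded linear operator. -/
noncomputable def numRange (A : H →L[ℂ] H) : Set ℂ :=
  {z : ℂ | ∃ x : H, ‖x‖ = 1 ∧ z = ⟪x, A x⟫}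

/-- The numerical radius of a bounded linear operator. -/
noncomputable def numRadius (A : H →L[ℂ] H) : ℝ :=
  sSup {r : ℝ | ∃ x : H, ‖x‖ = 1 ∧ r = ‖(⟪x, A x⟫)‖}

/-- The Crawford number of a bounded linear operator. -/
noncomputable def crawford (A : H →L[ℂ] H) : ℝ :=
  sInf {r : ℝ | ∃ x : H, ‖x‖ = 1 ∧ r = ‖(⟪x, A x⟫)‖}

/-- The real part `(A + A*)/2` of a bounded linear operator. -/
noncomputable def reOp (A : H →L[ℂ] H) : H →L[ℂ] H :=
  (2 : ℂ)⁻¹ • (A + ContinuousLinearMap.adjoint A)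

/-- The imaginary part `(A - A*)/(2i)` of a bounded linear operator. -/
noncomputable def imOp (A : H →L[ℂ] H) : H →L[ℂ] H :=
  (2 * Complex.I)⁻¹ • (A - ContinuousLinearMap.adjoint A)

/-- The numerical radius dominates the quadratic form at every unit vector. -/
theorem norm_inner_le_numRadius {H : Type*} [NormedAddCommGroup H] [InnerProductSpace ℂ H]
    (A : H →L[ℂ] H) {x : H} (hx : ‖x‖ = 1) :
    ‖⟪x, A x⟫‖ ≤ numRadius A := by
  refine le_csSup ⟨‖A‖, ?_⟩ ⟨x, hx, rfl⟩
  rintro r ⟨y, hy, rfl⟩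
  calc ‖⟪y, A y⟫‖ ≤ ‖y‖ * ‖A y‖ := norm_inner_le_norm _ _
    _ ≤ ‖y‖ * (‖A‖ * ‖y‖) := by gcongr; exact A.le_opNorm y
    _ = ‖A‖ := by simp [hy]

/-- The norm of a self-adjoint operator is bounded by any bound of its quadratic form on the
unit sphere. -/
theorem IsSelfAdjoint.norm_le_of_norm_inner_le {H : Type*} [NormedAddCommGroup H]
    [InnerProductSpace ℂ H] [CompleteSpace H] [Nontrivial H] {T : H →L[ℂ] H}
    (hT : IsSelfAdjoint T) {c : ℝ} (h : ∀ x, ‖x‖ = 1 → ‖⟪x, T x⟫‖ ≤ c) : ‖T‖ ≤ c := by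
  have hc : 0 ≤ c := by
    obtain ⟨x, hx⟩ := exists_norm_eq H zero_le_one
    exact (norm_nonneg _).trans (h x hx)
  rw [ContinuousLinearMap.norm_eq_iSup_rayleighQuotient T hT.isSymmetric]
  refine ciSup_le fun x => ?_
  rcases eq_or_ne x 0 with rfl | hx
  · simpa using hc
  have hn : ‖x‖ ≠ 0 := norm_ne_zero_iff.mpr hx
  have hk : ((‖x‖⁻¹ : ℝ) : ℂ) ≠ 0 := by exact_mod_cast inv_ne_zero hn
  have hu : ‖((‖x‖⁻¹ : ℝ) : ℂ) • x‖ = 1 := by simp [norm_smul, hn]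
  rw [← T.rayleigh_smul x hk, ContinuousLinearMap.rayleighQuotient, hu,
    ContinuousLinearMap.reApplyInnerSelf_apply, one_pow, div_one, inner_re_symm]
  exact (RCLike.abs_re_le_norm _).trans (h _ hu)

theorem norm_reOp_le_numRadius {H : Type*} [NormedAddCommGroup H] [InnerProductSpace ℂ H]
    [CompleteSpace H] [Nontrivial H] (A : H →L[ℂ] H) : ‖reOp A‖ ≤ numRadius A := by
  have hT : IsSelfAdjoint (reOp A) := by
    simp [IsSelfAdjoint, reOp, ← ContinuousLinearMap.star_eq_adjoint, add_comm]
  refine hT.norm_le_of_norm_inner_le fun x hx => ?_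
  have hA := norm_inner_le_numRadius A hx
  have hA' : ‖⟪x, ContinuousLinearMap.adjoint A x⟫‖ ≤ numRadius A := by
    rwa [ContinuousLinearMap.adjoint_inner_right, norm_inner_symm]
  have h := norm_add_le ⟪x, A x⟫ ⟪x, ContinuousLinearMap.adjoint A x⟫
  simp only [reOp, FunLike.coe_smul, Pi.smul_apply, add_apply, inner_smul_right, inner_add_right,
    norm_mul, norm_inv, RCLike.norm_ofNat]
  linarith

theorem imOp_eq_reOp {H : Type*} [NormedAddCommGroup H] [InnerProductSpace ℂ H]
    [CompleteSpace H] (A : H →L[ℂ] H) : imOp A = reOp (-Complex.I • A) := by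
  ext x
  simp [imOp, reOp, ← ContinuousLinearMap.star_eq_adjoint, smul_smul, smul_add, sub_eq_add_neg,
    mul_comm]

theorem numRadius_neg_I_smul {H : Type*} [NormedAddCommGroup H] [InnerProductSpace ℂ H]
    (A : H →L[ℂ] H) : numRadius (-Complex.I • A) = numRadius A := by
  simp [numRadius, inner_smul_right]

theorem norm_imOp_le_numRadius {H : Type*} [NormedAddCommGroup H] [InnerProductSpace ℂ H]
    [CompleteSpace H] [Nontrivial H] (A : H →L[ℂ] H) : ‖imOp A‖ ≤ numRadius A := by
  rw [imOp_eq_reOp, ← numRadius_neg_I_smul A]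
  exact norm_reOp_le_numRadius _

theorem reOp_add_I_smul_imOp {H : Type*} [NormedAddCommGroup H] [InnerProductSpace ℂ H]
    [CompleteSpace H] (A : H →L[ℂ] H) : reOp A + Complex.I • imOp A = A := by
  have h : Complex.I * (2 * Complex.I)⁻¹ = 2⁻¹ := by
    field_simp
  rw [reOp, imOp, smul_smul, h]
  module

/-- For every `A ∈ B(H)`, `w(A) ≥ ‖A‖/2 + |‖Re(A)‖ − ‖Im(A)‖|/2`. -/
theorem stmt0 (A : H →L[ℂ] H) :
    numRadius A ≥ ‖A‖ / 2 + |‖reOp A‖ - ‖imOp A‖| / 2 := by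
  have hA : ‖A‖ ≤ ‖reOp A‖ + ‖imOp A‖ := by
    calc ‖A‖ = ‖reOp A + Complex.I • imOp A‖ := by rw [reOp_add_I_smul_imOp]
      _ ≤ ‖reOp A‖ + ‖Complex.I • imOp A‖ := norm_add_le _ _
      _ = ‖reOp A‖ + ‖imOp A‖ := by simp [norm_smul]
  have hre := norm_reOp_le_numRadius A
  have him := norm_imOp_le_numRadius A
  rcases abs_cases (‖reOp A‖ - ‖imOp A‖) with h | h <;> linarith [h.1]
end

section
/- Let A, B ∈ B(H) be nonzero operators. Then ‖A + B‖ = ‖A‖ + ‖B‖ if and only if the real number ‖A‖·‖B‖ belongs to the closure of W(A*B). -/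
open ContinuousLinearMap Filter
open scoped ComplexInnerProductSpace Topology

variable {H : Type*} [NormedAddCommGroup H] [InnerProductSpace ℂ H]
  [CompleteSpace H] [Nontrivial H]

/-- A bounded operator nearly attains its norm on the unit sphere. -/
theorem exists_norm_eq_one_lt_norm_apply {E : Type*} [NormedAddCommGroup E]
    [InnerProductSpace ℂ E] [Nontrivial E] (T : E →L[ℂ] E) {c : ℝ} (hc : c < ‖T‖) :
    ∃ x : E, ‖x‖ = 1 ∧ c < ‖T x‖ := by
  obtain hc0 | hc0 := lt_or_ge c 0
  · obtain ⟨x, hx⟩ := exists_norm_eq E zero_le_one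
    exact ⟨x, hx, hc0.trans_le (norm_nonneg _)⟩
  · by_contra! h
    exact absurd (T.opNorm_le_of_unit_norm hc0 h) (not_le.mpr hc)

/-- The real part of any point of `W(A*B)` is controlled by `‖A + B‖`. -/
theorem re_mul_add_le_of_mem_numRange {E : Type*} [NormedAddCommGroup E]
    [InnerProductSpace ℂ E] [CompleteSpace E] (A B : E →L[ℂ] E) {z : ℂ}
    (hz : z ∈ numRange (adjoint A ∘L B)) :
    z.re * (‖A‖ + ‖B‖) ≤ ‖A + B‖ * (‖A‖ * ‖B‖) := by
  obtain ⟨x, hx, rfl⟩ := hz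
  rw [ContinuousLinearMap.comp_apply, adjoint_inner_right]
  have hAx : ‖A x‖ ≤ ‖A‖ := by simpa [hx] using A.le_opNorm x
  have hBx : ‖B x‖ ≤ ‖B‖ := by simpa [hx] using B.le_opNorm x
  have hABx : ‖A x + B x‖ ≤ ‖A + B‖ := by simpa [hx] using (A + B).le_opNorm x
  have hr : (⟪A x, B x⟫).re ≤ ‖A x‖ * ‖B‖ :=
    (re_inner_le_norm (𝕜 := ℂ) (A x) (B x)).trans (by gcongr)
  have hsum : ‖A x‖ ^ 2 + (⟪A x, B x⟫).re ≤ ‖A x‖ * ‖A + B‖ := by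
    have h := (re_inner_le_norm (𝕜 := ℂ) (A x) (A x + B x)).trans
      (mul_le_mul_of_nonneg_left hABx (norm_nonneg _))
    rw [inner_add_right, map_add, inner_self_eq_norm_sq] at h
    exact h
  generalize (⟪A x, B x⟫).re = r at *
  obtain hr0 | hr0 := le_or_gt r 0
  · exact (mul_nonpos_of_nonpos_of_nonneg hr0 (by positivity)).trans (by positivity)
  have hs : 0 < ‖A x‖ := by
    by_contra! h
    nlinarith [norm_nonneg B]
  refine le_of_mul_le_mul_left ?_ hs
  calc ‖A x‖ * (r * (‖A‖ + ‖B‖))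
      = ‖A x‖ * ‖A‖ * r + r * (‖A x‖ * ‖B‖) := by ring
    _ ≤ ‖A x‖ * ‖A‖ * (‖A x‖ * ‖B‖) + r * (‖A‖ * ‖B‖) := by gcongr
    _ = (‖A x‖ ^ 2 + r) * (‖A‖ * ‖B‖) := by ring
    _ ≤ ‖A x‖ * ‖A + B‖ * (‖A‖ * ‖B‖) := by gcongr
    _ = ‖A x‖ * (‖A + B‖ * (‖A‖ * ‖B‖)) := by ring

/-- If `‖z‖ ≤ p` then `z` is close to `p` as soon as its real part is. -/
theorem Complex.norm_ofReal_sub_sq_le {z : ℂ} {p : ℝ} (hz : ‖z‖ ≤ p) :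
    ‖(p : ℂ) - z‖ ^ 2 ≤ 2 * p * (p - z.re) := by
  have h : ‖z‖ ^ 2 ≤ p ^ 2 := by gcongr
  rw [Complex.sq_norm, Complex.normSq_apply] at h ⊢
  simp only [Complex.sub_re, Complex.sub_im, Complex.ofReal_re, Complex.ofReal_im]
  nlinarith

/-- For nonzero `A, B ∈ B(H)`, `‖A + B‖ = ‖A‖ + ‖B‖` iff
`‖A‖·‖B‖ ∈ closure W(A*B)`. -/
theorem stmt4 (A B : H →L[ℂ] H) (hA : A ≠ 0) (hB : B ≠ 0) :
    ‖A + B‖ = ‖A‖ + ‖B‖ ↔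
      ((‖A‖ * ‖B‖ : ℝ) : ℂ) ∈ closure (numRange (adjoint A ∘L B)) := by
  have ha : 0 < ‖A‖ := norm_pos_iff.mpr hA
  have hb : 0 < ‖B‖ := norm_pos_iff.mpr hB
  constructor
  · intro hAB
    rw [Metric.mem_closure_iff]
    intro δ hδ
    set K := 2 * (‖A‖ * ‖B‖) * (‖A‖ + ‖B‖) with hK
    have hK0 : 0 < K := by positivity
    set ε := min (δ ^ 2 / K) (‖A‖ + ‖B‖)
    have hε : 0 < ε := by positivity
    have hεK : K * ε ≤ δ ^ 2 := by
      rw [mul_comm, ← le_div_iff₀ hK0]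
      exact min_le_left _ _
    have hεab : ε ≤ ‖A‖ + ‖B‖ := min_le_right _ _
    obtain ⟨x, hx, hlt⟩ := exists_norm_eq_one_lt_norm_apply (A + B)
      (show ‖A‖ + ‖B‖ - ε < ‖A + B‖ by linarith)
    refine ⟨_, ⟨x, hx, rfl⟩, ?_⟩
    rw [ContinuousLinearMap.comp_apply, adjoint_inner_right, dist_eq_norm]
    have hAx : ‖A x‖ ≤ ‖A‖ := by simpa [hx] using A.le_opNorm x
    have hBx : ‖B x‖ ≤ ‖B‖ := by simpa [hx] using B.le_opNorm x
    have hz : ‖⟪A x, B x⟫‖ ≤ ‖A‖ * ‖B‖ := (norm_inner_le_norm _ _).trans (by gcongr)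
    have hsq : (‖A‖ + ‖B‖ - ε) ^ 2 < ‖A x + B x‖ ^ 2 :=
      pow_lt_pow_left₀ hlt (by linarith) two_ne_zero
    rw [norm_add_sq (𝕜 := ℂ), RCLike.re_eq_complex_re] at hsq
    have hA2 : ‖A x‖ ^ 2 ≤ ‖A‖ ^ 2 := by gcongr
    have hB2 : ‖B x‖ ^ 2 ≤ ‖B‖ ^ 2 := by gcongr
    have hre : ‖A‖ * ‖B‖ - (⟪A x, B x⟫).re < (‖A‖ + ‖B‖) * ε := by nlinarith
    refine lt_of_pow_lt_pow_left₀ 2 hδ.le ?_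
    calc _ ≤ 2 * (‖A‖ * ‖B‖) * (‖A‖ * ‖B‖ - (⟪A x, B x⟫).re) :=
          Complex.norm_ofReal_sub_sq_le hz
      _ < 2 * (‖A‖ * ‖B‖) * ((‖A‖ + ‖B‖) * ε) := by gcongr
      _ = K * ε := by rw [hK]; ring
      _ ≤ δ ^ 2 := hεK
  · intro h
    refine le_antisymm (norm_add_le A B) ?_
    have hclosed : IsClosed {z : ℂ | z.re * (‖A‖ + ‖B‖) ≤ ‖A + B‖ * (‖A‖ * ‖B‖)} :=
      isClosed_le (by fun_prop) continuous_const
    have hmem : ((‖A‖ * ‖B‖ : ℝ) : ℂ).re * (‖A‖ + ‖B‖) ≤ ‖A + B‖ * (‖A‖ * ‖B‖) :=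
      closure_minimal (fun _ hz => re_mul_add_le_of_mem_numRange A B hz) hclosed h
    rw [Complex.ofReal_re, mul_comm] at hmem
    exact le_of_mul_le_mul_right hmem (by positivity)
end

section
/- Let A ∈ B(H). If w(A) = ‖A‖/2, then ‖A‖² = ‖A*A + AA*‖ = ‖A*A − AA*‖. -/
open ContinuousLinearMap Filter
open scoped ComplexInnerProductSpace Topology

variable {H : Type*} [NormedAddCommGroup H] [InnerProductSpace ℂ H]
  [CompleteSpace H] [Nontrivial H]

section

variable {E : Type*} [NormedAddCommGroup E] [InnerProductSpace ℂ E]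

theorem bddAbove_norm_inner_apply_self (A : E →L[ℂ] E) :
    BddAbove {r : ℝ | ∃ x : E, ‖x‖ = 1 ∧ r = ‖(⟪x, A x⟫)‖} := by
  refine ⟨‖A‖, ?_⟩
  rintro r ⟨x, hx, rfl⟩
  calc ‖(⟪x, A x⟫)‖ ≤ ‖x‖ * ‖A x‖ := norm_inner_le_norm x (A x)
    _ ≤ ‖x‖ * (‖A‖ * ‖x‖) := by gcongr; exact A.le_opNorm x
    _ = ‖A‖ := by rw [hx]; ring

theorem norm_inner_apply_self_le_numRadius (A : E →L[ℂ] E) (x : E) :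
    ‖(⟪x, A x⟫)‖ ≤ numRadius A * ‖x‖ ^ 2 := by
  rcases eq_or_ne x 0 with rfl | hx
  · simp
  have hx' : ‖x‖ ≠ 0 := norm_ne_zero_iff.mpr hx
  have h := le_csSup (bddAbove_norm_inner_apply_self A)
    ⟨((‖x‖⁻¹ : ℝ) : ℂ) • x, by simp [norm_smul, hx'], rfl⟩
  have e : ‖(⟪((‖x‖⁻¹ : ℝ) : ℂ) • x, A (((‖x‖⁻¹ : ℝ) : ℂ) • x)⟫)‖ * ‖x‖ ^ 2
      = ‖(⟪x, A x⟫)‖ := by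
    simp only [map_smul, inner_smul_left, inner_smul_right, norm_mul, RCLike.norm_conj,
      Complex.norm_real, norm_inv, norm_norm]
    field_simp
  rw [← e]
  exact mul_le_mul_of_nonneg_right h (by positivity)

theorem abs_re_inner_apply_self_le_opNorm (T : E →L[ℂ] E) (x : E) :
    |(⟪T x, x⟫).re| ≤ ‖T‖ * ‖x‖ ^ 2 := by
  calc |(⟪T x, x⟫).re| ≤ ‖(⟪T x, x⟫)‖ := Complex.abs_re_le_norm _
    _ ≤ ‖T x‖ * ‖x‖ := norm_inner_le_norm _ _
    _ ≤ ‖T‖ * ‖x‖ * ‖x‖ := by gcongr; exact T.le_opNorm x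
    _ = ‖T‖ * ‖x‖ ^ 2 := by ring

theorem ContinuousLinearMap.opNorm_sq_le_of_norm_sq_le (A : E →L[ℂ] E) {c : ℝ} (hc : 0 ≤ c)
    (h : ∀ x, ‖A x‖ ^ 2 ≤ c * ‖x‖ ^ 2) : ‖A‖ ^ 2 ≤ c := by
  refine (Real.le_sqrt (norm_nonneg A) hc).mp
    (A.opNorm_le_bound (Real.sqrt_nonneg c) fun x => ?_)
  rw [← pow_le_pow_iff_left₀ (norm_nonneg _) (by positivity) two_ne_zero, mul_pow, Real.sq_sqrt hc]
  exact h x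

variable [CompleteSpace E]

theorem IsSelfAdjoint.norm_le_of_abs_re_inner_le {T : E →L[ℂ] E} (hT : IsSelfAdjoint T)
    {c : ℝ} (hc : 0 ≤ c) (h : ∀ x, |(⟪T x, x⟫).re| ≤ c * ‖x‖ ^ 2) : ‖T‖ ≤ c := by
  rw [T.norm_eq_iSup_rayleighQuotient hT.isSymmetric]
  refine ciSup_le fun x => ?_
  rw [rayleighQuotient, abs_div, abs_sq]
  exact div_le_of_le_mul₀ (by positivity) hc (h x)

theorem norm_add_adjoint_le (A : E →L[ℂ] E) {c : ℝ} (hc : 0 ≤ c)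
    (h : ∀ x, ‖(⟪x, A x⟫)‖ ≤ c * ‖x‖ ^ 2) : ‖A + adjoint A‖ ≤ 2 * c := by
  have hA : IsSelfAdjoint (A + adjoint A) := IsSelfAdjoint.add_star_self A
  refine hA.norm_le_of_abs_re_inner_le (by positivity) fun x => ?_
  have e : (⟪(A + adjoint A) x, x⟫).re = 2 * (⟪x, A x⟫).re := by
    rw [add_apply, inner_add_left, adjoint_inner_left, ← inner_conj_symm (A x) x,
      Complex.add_re, Complex.conj_re, two_mul]
  rw [e, abs_mul, abs_two, mul_assoc]
  gcongr
  exact (Complex.abs_re_le_norm _).trans (h x)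

theorem norm_sub_adjoint_le (A : E →L[ℂ] E) {c : ℝ} (hc : 0 ≤ c)
    (h : ∀ x, ‖(⟪x, A x⟫)‖ ≤ c * ‖x‖ ^ 2) : ‖A - adjoint A‖ ≤ 2 * c := by
  have e : Complex.I • A + adjoint (Complex.I • A) = Complex.I • (A - adjoint A) := by
    rw [map_smulₛₗ, Complex.conj_I, smul_sub, neg_smul, sub_eq_add_neg]
  have := norm_add_adjoint_le (Complex.I • A) hc fun x => by
    simpa [inner_smul_right] using h x
  rwa [e, norm_smul, Complex.norm_I, one_mul] at this

/-- If the numerical range of `A` lies in the disc of radius `c`, then `A*A + AA* ≤ 4c²`. -/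
theorem norm_sq_add_norm_adjoint_sq_le (A : E →L[ℂ] E) {c : ℝ} (hc : 0 ≤ c)
    (h : ∀ x, ‖(⟪x, A x⟫)‖ ≤ c * ‖x‖ ^ 2) (x : E) :
    ‖A x‖ ^ 2 + ‖adjoint A x‖ ^ 2 ≤ (2 * c) ^ 2 * ‖x‖ ^ 2 := by
  have hp := (A + adjoint A).le_of_opNorm_le (norm_add_adjoint_le A hc h) x
  have hm := (A - adjoint A).le_of_opNorm_le (norm_sub_adjoint_le A hc h) x
  rw [add_apply] at hp
  rw [sub_apply] at hm
  have hp' := pow_le_pow_left₀ (norm_nonneg _) hp 2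
  have hm' := pow_le_pow_left₀ (norm_nonneg _) hm 2
  have hpar := parallelogram_law_with_norm ℂ (A x) (adjoint A x)
  nlinarith

theorem re_inner_adjoint_comp_self (A : E →L[ℂ] E) (x : E) :
    (⟪(adjoint A ∘L A) x, x⟫).re = ‖A x‖ ^ 2 :=
  (apply_norm_sq_eq_inner_adjoint_left A x).symm

theorem re_inner_self_comp_adjoint (A : E →L[ℂ] E) (x : E) :
    (⟪(A ∘L adjoint A) x, x⟫).re = ‖adjoint A x‖ ^ 2 := by
  simpa only [adjoint_adjoint] using re_inner_adjoint_comp_self (adjoint A) x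

end

/-- If `w(A) = ‖A‖/2`, then `‖A‖² = ‖A*A + AA*‖ = ‖A*A − AA*‖`. -/
theorem stmt5 (A : H →L[ℂ] H) (h : numRadius A = ‖A‖ / 2) :
    ‖A‖ ^ 2 = ‖adjoint A ∘L A + A ∘L adjoint A‖ ∧
      ‖A‖ ^ 2 = ‖adjoint A ∘L A - A ∘L adjoint A‖ := by
  have key (x : H) : ‖A x‖ ^ 2 + ‖adjoint A x‖ ^ 2 ≤ ‖A‖ ^ 2 * ‖x‖ ^ 2 := by
    have := norm_sq_add_norm_adjoint_sq_le A (c := ‖A‖ / 2) (by positivity)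
      (fun x => h ▸ norm_inner_apply_self_le_numRadius A x) x
    rwa [mul_div_cancel₀ _ (two_ne_zero' ℝ)] at this
  have hsum (x : H) : (⟪(adjoint A ∘L A + A ∘L adjoint A) x, x⟫).re
      = ‖A x‖ ^ 2 + ‖adjoint A x‖ ^ 2 := by
    rw [add_apply, inner_add_left, Complex.add_re, re_inner_adjoint_comp_self,
      re_inner_self_comp_adjoint]
  have hdiff (x : H) : (⟪(adjoint A ∘L A - A ∘L adjoint A) x, x⟫).re
      = ‖A x‖ ^ 2 - ‖adjoint A x‖ ^ 2 := by
    rw [sub_apply, inner_sub_left, Complex.sub_re, re_inner_adjoint_comp_self,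
      re_inner_self_comp_adjoint]
  have hs₁ : IsSelfAdjoint (adjoint A ∘L A) := IsSelfAdjoint.star_mul_self A
  have hs₂ : IsSelfAdjoint (A ∘L adjoint A) := IsSelfAdjoint.mul_star_self A
  refine ⟨le_antisymm ?_ ?_, le_antisymm ?_ ?_⟩
  · refine A.opNorm_sq_le_of_norm_sq_le (norm_nonneg _) fun x => ?_
    have := (le_abs_self _).trans
      (abs_re_inner_apply_self_le_opNorm (adjoint A ∘L A + A ∘L adjoint A) x)
    rw [hsum] at this
    linarith [sq_nonneg ‖adjoint A x‖]
  · refine (hs₁.add hs₂).norm_le_of_abs_re_inner_le (by positivity) fun x => ?_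
    rw [hsum, abs_of_nonneg (by positivity)]
    exact key x
  · have := A.opNorm_sq_le_of_norm_sq_le
      (c := (‖adjoint A ∘L A - A ∘L adjoint A‖ + ‖A‖ ^ 2) / 2) (by positivity) fun x => by
        have := (le_abs_self _).trans
          (abs_re_inner_apply_self_le_opNorm (adjoint A ∘L A - A ∘L adjoint A) x)
        rw [hdiff] at this
        linarith [key x]
    linarith
  · refine (hs₁.sub hs₂).norm_le_of_abs_re_inner_le (by positivity) fun x => ?_
    rw [hdiff, abs_le]
    constructor <;> linarith [key x, sq_nonneg ‖A x‖, sq_nonneg ‖adjoint A x‖]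
end

section
/- Let A ∈ B(H). Then w(A) = ‖A‖/2 if and only if the closure of W(A) is the closed disk {z ∈ ℂ : |z| ≤ ‖A‖/2} centered at the origin with radius ‖A‖/2. -/
open ContinuousLinearMap Filter
open scoped ComplexInnerProductSpace Topology

variable {H : Type*} [NormedAddCommGroup H] [InnerProductSpace ℂ H]
  [CompleteSpace H] [Nontrivial H]

set_option linter.unusedSectionVars false

lemma inner_add_smul_map (A : H →L[ℂ] H) (x : H) (s μ : ℂ) :
    ⟪s • x + μ • A x, A (s • x + μ • A x)⟫ =
      starRingEnd ℂ s * s * ⟪x, A x⟫ + starRingEnd ℂ s * μ * ⟪x, A (A x)⟫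
        + starRingEnd ℂ μ * s * (‖A x‖ : ℂ) ^ 2 + starRingEnd ℂ μ * μ * ⟪A x, A (A x)⟫ := by
  simp only [map_add, map_smul, inner_add_left, inner_add_right, inner_smul_left, inner_smul_right,
    inner_self_eq_norm_sq_to_K]
  simp only [Complex.coe_algebraMap]
  ring

lemma norm_sq_add_smul_map (A : H →L[ℂ] H) {x : H} (hx : ‖x‖ = 1) (s μ : ℂ) :
    ‖s • x + μ • A x‖ ^ 2 =
      ‖s‖ ^ 2 + ‖μ‖ ^ 2 * ‖A x‖ ^ 2 + 2 * (starRingEnd ℂ s * μ * ⟪x, A x⟫).re := by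
  rw [@norm_add_sq ℂ, inner_smul_left, inner_smul_right, norm_smul, norm_smul, hx]
  simp only [RCLike.re_to_complex, mul_assoc]
  ring

/-- If `|⟪u, A u⟫| ≤ ‖u‖² / 2` everywhere, then the compression of `A` to `x, A x` is controlled by
the defect `1 - ‖A x‖²`. -/
lemma re_unit_mul_inner_le {A : H →L[ℂ] H} (hw : ∀ u : H, ‖⟪u, A u⟫‖ ≤ ‖u‖ ^ 2 / 2)
    {x : H} (hx : ‖x‖ = 1) {μ : ℂ} (hμ : ‖μ‖ = 1) :
    (μ * ⟪A x, A (A x)⟫).re + (μ ^ 2 * ⟪x, A (A x)⟫).re ≤ (1 - ‖A x‖ ^ 2) / 2 := by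
  have h := hw ((1 : ℂ) • x + μ • A x)
  rw [norm_sq_add_smul_map A hx, inner_add_smul_map] at h
  have hμ' : μ * starRingEnd ℂ μ = 1 := by
    rw [Complex.mul_conj', hμ]; simp
  have e : μ * (starRingEnd ℂ 1 * 1 * ⟪x, A x⟫ + starRingEnd ℂ 1 * μ * ⟪x, A (A x)⟫
        + starRingEnd ℂ μ * 1 * (‖A x‖ : ℂ) ^ 2 + starRingEnd ℂ μ * μ * ⟪A x, A (A x)⟫)
      = μ * ⟪x, A x⟫ + μ ^ 2 * ⟪x, A (A x)⟫ + ((‖A x‖ ^ 2 : ℝ) : ℂ)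
        + μ * ⟪A x, A (A x)⟫ := by
    simp only [map_one, Complex.ofReal_pow]
    linear_combination ((‖A x‖ : ℂ) ^ 2 + μ * ⟪A x, A (A x)⟫) * hμ'
  rw [← one_mul ‖_ + _‖, ← hμ, ← norm_mul, e] at h
  have key := (Complex.re_le_norm _).trans h
  simp only [Complex.add_re, Complex.ofReal_re, hμ, norm_one, map_one, one_mul] at key
  linarith

lemma norm_inner_map_map_le {A : H →L[ℂ] H} (hw : ∀ u : H, ‖⟪u, A u⟫‖ ≤ ‖u‖ ^ 2 / 2)
    {x : H} (hx : ‖x‖ = 1) : ‖⟪A x, A (A x)⟫‖ ≤ 1 - ‖A x‖ ^ 2 := by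
  have h1 := re_unit_mul_inner_le hw hx (μ := 1) (by simp)
  have h2 := re_unit_mul_inner_le hw hx (μ := -1) (by simp)
  have h3 := re_unit_mul_inner_le hw hx (μ := Complex.I) (by simp)
  have h4 := re_unit_mul_inner_le hw hx (μ := -Complex.I) (by simp)
  simp at h1 h2 h3 h4
  refine (Complex.norm_le_abs_re_add_abs_im _).trans ?_
  rcases abs_cases (⟪A x, A (A x)⟫).re with h | h <;>
    rcases abs_cases (⟪A x, A (A x)⟫).im with h' | h' <;> linarith

lemma norm_inner_self_map_map_le {A : H →L[ℂ] H} (hw : ∀ u : H, ‖⟪u, A u⟫‖ ≤ ‖u‖ ^ 2 / 2)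
    {x : H} (hx : ‖x‖ = 1) : ‖⟪x, A (A x)⟫‖ ≤ (1 - ‖A x‖ ^ 2) / 2 := by
  set c := ⟪x, A (A x)⟫ with hc
  set μ := Complex.exp (((-(c.arg / 2) : ℝ) : ℂ) * Complex.I) with hμ
  have hn : ‖μ‖ = 1 := Complex.norm_exp_ofReal_mul_I _
  have hmc : μ ^ 2 * c = (‖c‖ : ℂ) := by
    conv_lhs => rw [← Complex.norm_mul_exp_arg_mul_I c]
    rw [hμ, ← Complex.exp_nat_mul, mul_left_comm, ← Complex.exp_add]
    have : ((2 : ℕ) : ℂ) * (((-(c.arg / 2) : ℝ) : ℂ) * Complex.I) + c.arg * Complex.I = 0 := by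
      push_cast; ring
    rw [this]; simp
  have h1 := re_unit_mul_inner_le hw hx hn
  have h2 := re_unit_mul_inner_le hw hx (μ := -μ) (by simpa using hn)
  rw [neg_sq] at h2
  rw [← hc, hmc, Complex.ofReal_re] at h1 h2
  rw [neg_mul, Complex.neg_re] at h2
  linarith

lemma norm_inner_map_map_sub_le {A : H →L[ℂ] H} (hA : ‖A‖ = 1) {x : H} (hx : ‖x‖ = 1) :
    ‖⟪A x, A (A x)⟫ - ⟪x, A x⟫‖ ≤ √(1 - ‖A x‖ ^ 2) := by
  have hy : ‖A x‖ ≤ 1 := by simpa [hA, hx] using A.le_opNorm x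
  have hz : ‖adjoint A (A x)‖ ≤ ‖A x‖ := by
    simpa [hA] using (adjoint A).le_opNorm (A x)
  have hsq : ‖adjoint A (A x) - x‖ ^ 2 ≤ 1 - ‖A x‖ ^ 2 := by
    rw [@norm_sub_sq ℂ, adjoint_inner_left, inner_self_eq_norm_sq, hx]
    nlinarith [norm_nonneg (adjoint A (A x))]
  rw [← adjoint_inner_left, ← inner_sub_left]
  refine (norm_inner_le_norm _ _).trans ((mul_le_of_le_one_right (norm_nonneg _) hy).trans ?_)
  exact Real.le_sqrt_of_sq_le hsq

lemma exists_sq_add_normSq_eq_one {z : ℂ} (hz : ‖z‖ ≤ 1 / 2) :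
    ∃ (s : ℝ) (μ : ℂ), s ^ 2 + ‖μ‖ ^ 2 = 1 ∧ starRingEnd ℂ μ * s = z := by
  set d := √(1 - 4 * ‖z‖ ^ 2) with hd
  have hd0 : 0 ≤ d := Real.sqrt_nonneg _
  have hd2 : d ^ 2 = 1 - 4 * ‖z‖ ^ 2 := Real.sq_sqrt (by nlinarith [norm_nonneg z])
  set s := √((1 + d) / 2) with hs
  have hs0 : 0 < s := Real.sqrt_pos.2 (by positivity)
  have hs2 : s ^ 2 = (1 + d) / 2 := Real.sq_sqrt (by positivity)
  refine ⟨s, starRingEnd ℂ z / s, ?_, ?_⟩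
  · rw [norm_div, RCLike.norm_conj, Complex.norm_real, Real.norm_of_nonneg hs0.le, div_pow, hs2]
    field_simp
    nlinarith
  · have : (s : ℂ) ≠ 0 := by exact_mod_cast hs0.ne'
    simp [this]

lemma exists_unit_seq_tendsto_norm (A : H →L[ℂ] H) :
    ∃ x : ℕ → H, (∀ n, ‖x n‖ = 1) ∧ Tendsto (fun n => ‖A (x n)‖) atTop (𝓝 ‖A‖) := by
  have hne : ((fun x => ‖A x‖) '' Metric.sphere (0 : H) 1).Nonempty :=
    (NormedSpace.sphere_nonempty.2 zero_le_one).image _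
  have hex : ∀ n : ℕ, ∃ x : H, ‖x‖ = 1 ∧ ‖A‖ - 1 / ((n : ℝ) + 1) < ‖A x‖ := by
    intro n
    have hlt : ‖A‖ - 1 / ((n : ℝ) + 1) < sSup ((fun x => ‖A x‖) '' Metric.sphere (0 : H) 1) := by
      rw [A.sSup_sphere_eq_norm]
      exact sub_lt_self _ (by positivity)
    obtain ⟨_, ⟨x, hx, rfl⟩, h⟩ := exists_lt_of_lt_csSup hne hlt
    exact ⟨x, by simpa using hx, h⟩
  choose x hx hlt using hex
  refine ⟨x, hx, tendsto_of_tendsto_of_tendsto_of_le_of_le ?_ tendsto_const_nhds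
    (fun n => (hlt n).le) fun n => by simpa [hx n] using A.le_opNorm (x n)⟩
  simpa using tendsto_const_nhds.sub (tendsto_one_div_add_atTop_nhds_zero_nat (𝕜 := ℝ))

lemma inner_div_norm_sq_mem_numRange (A : H →L[ℂ] H) {u : H} (hu : u ≠ 0) :
    ⟪u, A u⟫ / (‖u‖ ^ 2 : ℝ) ∈ numRange A := by
  have hu' : (‖u‖ : ℂ) ≠ 0 := by exact_mod_cast norm_ne_zero_iff.2 hu
  refine ⟨(‖u‖⁻¹ : ℂ) • u, by simp [norm_smul, hu], ?_⟩
  rw [map_smul, inner_smul_left, inner_smul_right, map_inv₀, Complex.conj_ofReal]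
  push_cast
  field_simp

lemma mem_closure_numRange_of_norm_eq_one {A : H →L[ℂ] H} (hA : ‖A‖ = 1)
    (hw : ∀ u : H, ‖⟪u, A u⟫‖ ≤ ‖u‖ ^ 2 / 2) {z : ℂ} (hz : ‖z‖ ≤ 1 / 2) :
    z ∈ closure (numRange A) := by
  obtain ⟨s, μ, hsμ, hz⟩ := exists_sq_add_normSq_eq_one hz
  obtain ⟨x, hx, hlim⟩ := exists_unit_seq_tendsto_norm A
  rw [hA] at hlim
  have hdef : Tendsto (fun n => 1 - ‖A (x n)‖ ^ 2) atTop (𝓝 0) := by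
    simpa using (hlim.pow 2).const_sub 1
  have hb : Tendsto (fun n => ⟪A (x n), A (A (x n))⟫) atTop (𝓝 0) :=
    squeeze_zero_norm (fun n => norm_inner_map_map_le hw (hx n)) hdef
  have hc : Tendsto (fun n => ⟪x n, A (A (x n))⟫) atTop (𝓝 0) :=
    squeeze_zero_norm (fun n => norm_inner_self_map_map_le hw (hx n))
      (by simpa using hdef.div_const 2)
  have hba : Tendsto (fun n => ⟪A (x n), A (A (x n))⟫ - ⟪x n, A (x n)⟫) atTop (𝓝 0) :=
    squeeze_zero_norm (fun n => norm_inner_map_map_sub_le hA (hx n)) (by simpa using hdef.sqrt)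
  have ha : Tendsto (fun n => ⟪x n, A (x n)⟫) atTop (𝓝 0) := by
    simpa using hb.sub hba
  have hlimC : Tendsto (fun n => (‖A (x n)‖ : ℂ)) atTop (𝓝 1) := by
    simpa [Function.comp_def] using (Complex.continuous_ofReal.tendsto 1).comp hlim
  set u : ℕ → H := fun n => (s : ℂ) • x n + μ • A (x n) with hu
  have hnum : Tendsto (fun n => ⟪u n, A (u n)⟫) atTop (𝓝 z) := by
    simp only [hu, inner_add_smul_map, Complex.conj_ofReal]
    have h := (((ha.const_mul ((s : ℂ) * s)).add (hc.const_mul (s * μ))).add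
      ((hlimC.pow 2).const_mul (starRingEnd ℂ μ * s))).add (hb.const_mul (starRingEnd ℂ μ * μ))
    simpa [hz] using h
  have hden : Tendsto (fun n => ‖u n‖ ^ 2) atTop (𝓝 1) := by
    have e : ∀ n, ‖u n‖ ^ 2 = _ := fun n => norm_sq_add_smul_map A (hx n) s μ
    simp only [e]
    have h := (((hlim.pow 2).const_mul (‖μ‖ ^ 2)).const_add (‖(s : ℂ)‖ ^ 2)).add
      (((Complex.continuous_re.tendsto _).comp
        (ha.const_mul (starRingEnd ℂ (s : ℂ) * μ))).const_mul 2)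
    simpa [hsμ] using h
  have hquot : Tendsto (fun n => ⟪u n, A (u n)⟫ / (‖u n‖ ^ 2 : ℝ)) atTop (𝓝 z) := by
    simpa [Function.comp_def, Pi.div_def] using hnum.div ((Complex.continuous_ofReal.tendsto 1).comp hden) (by simp)
  refine mem_closure_of_tendsto hquot ?_
  filter_upwards [hden.eventually_ne one_ne_zero] with n hn
  exact inner_div_norm_sq_mem_numRange A (by rintro h; simp [h] at hn)

lemma bddAbove_norm_inner_map_self (A : H →L[ℂ] H) :
    BddAbove {r : ℝ | ∃ x : H, ‖x‖ = 1 ∧ r = ‖(⟪x, A x⟫)‖} := by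
  refine ⟨‖A‖, ?_⟩
  rintro _ ⟨x, hx, rfl⟩
  refine (norm_inner_le_norm _ _).trans ?_
  simpa [hx] using A.le_opNorm x

lemma norm_le_numRadius {A : H →L[ℂ] H} {z : ℂ} (hz : z ∈ numRange A) : ‖z‖ ≤ numRadius A := by
  obtain ⟨x, hx, rfl⟩ := hz
  exact le_csSup (bddAbove_norm_inner_map_self A) ⟨x, hx, rfl⟩

lemma numRange_nonempty (A : H →L[ℂ] H) : (numRange A).Nonempty := by
  obtain ⟨x, hx⟩ := exists_norm_eq H zero_le_one
  exact ⟨_, x, hx, rfl⟩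

lemma norm_inner_map_self_le_numRadius (A : H →L[ℂ] H) (u : H) :
    ‖⟪u, A u⟫‖ ≤ numRadius A * ‖u‖ ^ 2 := by
  rcases eq_or_ne u 0 with rfl | hu
  · simp
  have h := norm_le_numRadius (inner_div_norm_sq_mem_numRange A hu)
  have hpos : 0 < ‖u‖ ^ 2 := by positivity
  rwa [norm_div, Complex.norm_real, Real.norm_of_nonneg hpos.le, div_le_iff₀ hpos] at h

lemma closure_numRange_subset (A : H →L[ℂ] H) :
    closure (numRange A) ⊆ {z : ℂ | ‖z‖ ≤ numRadius A} :=
  closure_minimal (fun _ hz => norm_le_numRadius hz) (isClosed_le continuous_norm continuous_const)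

lemma mul_mem_closure_numRange_smul (A : H →L[ℂ] H) (c : ℂ) {z : ℂ}
    (hz : z ∈ closure (numRange A)) : c * z ∈ closure (numRange (c • A)) := by
  refine map_mem_closure (continuous_const_mul c) hz ?_
  rintro _ ⟨x, hx, rfl⟩
  exact ⟨x, hx, by simp⟩

lemma disk_subset_closure_numRange {A : H →L[ℂ] H} (hw : numRadius A = ‖A‖ / 2) :
    {z : ℂ | ‖z‖ ≤ ‖A‖ / 2} ⊆ closure (numRange A) := by
  intro z (hz : ‖z‖ ≤ ‖A‖ / 2)
  rcases eq_or_ne A 0 with rfl | hA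
  · obtain ⟨x, hx⟩ := exists_norm_eq H zero_le_one
    exact subset_closure ⟨x, hx, by simpa using hz⟩
  have hpos : 0 < ‖A‖ := norm_pos_iff.2 hA
  have hne : (‖A‖ : ℂ) ≠ 0 := by exact_mod_cast hpos.ne'
  have hB : ‖(‖A‖ : ℂ)⁻¹ • A‖ = 1 := by
    simp [norm_smul, hpos.ne']
  have hwB : ∀ u : H, ‖⟪u, ((‖A‖ : ℂ)⁻¹ • A) u⟫‖ ≤ ‖u‖ ^ 2 / 2 := by
    intro u
    have h := norm_inner_map_self_le_numRadius A u
    rw [hw] at h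
    rw [smul_apply, inner_smul_right, norm_mul, norm_inv, Complex.norm_real, norm_norm,
      inv_mul_le_iff₀ hpos]
    linarith
  have hzB : ‖(‖A‖ : ℂ)⁻¹ * z‖ ≤ 1 / 2 := by
    rw [norm_mul, norm_inv, Complex.norm_real, norm_norm, inv_mul_le_iff₀ hpos]
    linarith
  have h := mul_mem_closure_numRange_smul _ (‖A‖ : ℂ)
    (mem_closure_numRange_of_norm_eq_one hB hwB hzB)
  rwa [smul_smul, mul_inv_cancel₀ hne, one_smul, mul_inv_cancel_left₀ hne] at h

/-- `w(A) = ‖A‖/2` iff the closure of `W(A)` is the closed disk centered at the origin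
of radius `‖A‖/2`. -/
theorem stmt15 (A : H →L[ℂ] H) :
    numRadius A = ‖A‖ / 2 ↔ closure (numRange A) = {z : ℂ | ‖z‖ ≤ ‖A‖ / 2} := by
  refine ⟨fun hw => ?_, fun h => le_antisymm ?_ ?_⟩
  · exact (hw ▸ closure_numRange_subset A).antisymm (disk_subset_closure_numRange hw)
  · obtain ⟨_, x, hx, -⟩ := numRange_nonempty A
    refine csSup_le ⟨_, x, hx, rfl⟩ ?_
    rintro _ ⟨y, hy, rfl⟩
    exact h.subset (subset_closure ⟨y, hy, rfl⟩)
  · have hmem : ((‖A‖ / 2 : ℝ) : ℂ) ∈ closure (numRange A) := by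
      rw [h]
      simp
    have hle : ‖((‖A‖ / 2 : ℝ) : ℂ)‖ ≤ numRadius A := closure_numRange_subset A hmem
    rwa [Complex.norm_real, Real.norm_of_nonneg (by positivity)] at hle
end
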